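/- arXiv:1901.02135 — 2 statements merged into one kernel-verified Lean document; each statement's English description precedes it below -/
import Mathlib

section
/- (Variational principle for Bowen entropy of flows.) Let (X,d) be a compact metric space and φ a continuous flow on X without fixed points. If K is a non-empty compact subset of X, then h_top^B(φ, K) = sup{ underline h_μ(φ) : μ a Borel probability measure on X with μ(K)=1 }, where underline h_μ(φ) = ∫_X underline h_μ(φ,x) dμ(x). -/
open MeasureTheory Filter Set Topology
open scoped ENNReal NNReal

namespace FlowEntropy

variable {X : Type*}

/-- A continuous flow on `X`. -/
structure IsFlow [TopologicalSpace X] (φ : ℝ → X → X) : Prop where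
  cont : Continuous fun p : ℝ × X => φ p.1 p.2
  map_zero : ∀ x, φ 0 x = x
  map_add : ∀ s t : ℝ, ∀ x, φ (s + t) x = φ s (φ t x)

/-- The flow has no fixed points. -/
def FixedPointFree (φ : ℝ → X → X) : Prop :=
  ∀ x : X, ∃ t : ℝ, φ t x ≠ x

/-- The measure `μ` is invariant under every time-`t` map of the flow. -/
def FlowInvariant [MeasurableSpace X] (φ : ℝ → X → X) (μ : Measure X) : Prop :=
  ∀ t : ℝ, MeasurePreserving (φ t) μ μ

/-- The measure `μ` is invariant and ergodic for the flow: every Borel set invariant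
under all time-`t` maps has measure `0` or `1`. -/
def FlowErgodic [MeasurableSpace X] (φ : ℝ → X → X) (μ : Measure X) : Prop :=
  FlowInvariant φ μ ∧
    ∀ B : Set X, MeasurableSet B → (∀ t : ℝ, φ t ⁻¹' B = B) → μ B = 0 ∨ μ B = 1

/-- `α` is a reparametrization on the closed interval `I` (containing the origin):
a continuous map that is a homeomorphism onto its image (equivalently, continuous and
injective on the compact interval), fixing the origin. -/
def IsReparOn (α : ℝ → ℝ) (I : Set ℝ) : Prop :=
  ContinuousOn α I ∧ Set.InjOn α I ∧ α 0 = 0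

/-- The reparametrization ball `B(x, t, ε, φ)`. -/
def reparBall [PseudoMetricSpace X] (φ : ℝ → X → X) (x : X) (t ε : ℝ) : Set X :=
  {y : X | ∃ α : ℝ → ℝ, IsReparOn α (Set.Icc 0 t) ∧
      ∀ s ∈ Set.Icc (0 : ℝ) t, dist (φ (α s) x) (φ s y) < ε}

/-- `M^s_{N,ε}(φ, Z)`: infimum of `Σ_i exp (-s t_i)` over countable families of
reparametrization balls `B(x_i, t_i, ε, φ)` with `t_i ≥ N` covering `Z`. -/
noncomputable def coverM [PseudoMetricSpace X] (φ : ℝ → X → X) (Z : Set X) (s : ℝ) (N : ℕ)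
    (ε : ℝ) : ℝ≥0∞ :=
  ⨅ (F : Set (X × ℝ)) (_ : F.Countable) (_ : ∀ p ∈ F, (N : ℝ) ≤ p.2)
    (_ : Z ⊆ ⋃ p ∈ F, reparBall φ p.1 p.2 ε),
    ∑' p : F, ENNReal.ofReal (Real.exp (-s * (p : X × ℝ).2))

/-- `M^s_ε(φ, Z) = lim_{N → ∞} M^s_{N,ε}(φ, Z)` (an increasing limit). -/
noncomputable def coverMeps [PseudoMetricSpace X] (φ : ℝ → X → X) (Z : Set X) (s ε : ℝ) :
    ℝ≥0∞ :=
  ⨆ N : ℕ, coverM φ Z s N ε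

/-- `M^s(φ, Z) = lim_{ε → 0} M^s_ε(φ, Z)` (an increasing limit as `ε` decreases). -/
noncomputable def coverMlim [PseudoMetricSpace X] (φ : ℝ → X → X) (Z : Set X) (s : ℝ) :
    ℝ≥0∞ :=
  ⨆ (ε : ℝ) (_ : 0 < ε), coverMeps φ Z s ε

/-- The Bowen entropy `h_top^B(φ, Z)`: the critical value where `M^s(φ,Z)` jumps
from `∞` to `0` (as an extended nonnegative real; `⊤` if no finite critical value). -/
noncomputable def bowenEntropy [PseudoMetricSpace X] (φ : ℝ → X → X) (Z : Set X) : ℝ≥0∞ :=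
  ⨅ (s : ℝ) (_ : 0 ≤ s) (_ : coverMlim φ Z s = 0), ENNReal.ofReal s

/-- Static entropy of a finite measurable partition, encoded as a map into a finite type. -/
noncomputable def partEnt [MeasurableSpace X] (μ : Measure X) {ι : Type*} [Fintype ι]
    (P : X → ι) : ℝ :=
  ∑ i : ι, Real.negMulLog ((μ (P ⁻¹' {i})).toReal)

/-- The measure-theoretic (Kolmogorov–Sinai) entropy of a map `T` with respect to `μ`:
the supremum over finite measurable partitions of the asymptotic entropy per unit time of
the dynamical refinements. -/
noncomputable def kolSinai [MeasurableSpace X] (μ : Measure X) (T : X → X) : ℝ≥0∞ :=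
  ⨆ (k : ℕ) (P : X → Fin k) (_ : Measurable P),
    Filter.limsup (fun n : ℕ =>
      ENNReal.ofReal (partEnt μ (fun x => fun j : Fin n => P (T^[(j : ℕ)] x)) / n))
      Filter.atTop

/-- `-log a` as a member of `ℝ≥0∞`, for `a ∈ [0,1]` (with `-log 0 = ∞`). -/
noncomputable def negLogNN (a : ℝ≥0∞) : ℝ≥0∞ :=
  if a = 0 then ⊤ else ENNReal.ofReal (-Real.log a.toReal)

/-- `-(1/t) log μ(B(x,t,ε,φ))`, as a member of `ℝ≥0∞`. -/
noncomputable def localRate [PseudoMetricSpace X] [MeasurableSpace X] (μ : Measure X)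
    (φ : ℝ → X → X) (x : X) (ε t : ℝ) : ℝ≥0∞ :=
  negLogNN (μ (reparBall φ x t ε)) / ENNReal.ofReal t

/-- The lower local entropy `underline h_μ(φ, x) = lim_{ε→0} liminf_{t→∞}
  -(1/t) log μ(B(x,t,ε,φ))` (the limit in `ε` is an increasing limit, hence a supremum). -/
noncomputable def lowerLocalEnt [PseudoMetricSpace X] [MeasurableSpace X] (μ : Measure X)
    (φ : ℝ → X → X) (x : X) : ℝ≥0∞ :=
  ⨆ (ε : ℝ) (_ : 0 < ε), Filter.liminf (fun t : ℝ => localRate μ φ x ε t) Filter.atTop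

/-- The upper local entropy `overline h_μ(φ, x) = lim_{ε→0} limsup_{t→∞}
  -(1/t) log μ(B(x,t,ε,φ))`. -/
noncomputable def upperLocalEnt [PseudoMetricSpace X] [MeasurableSpace X] (μ : Measure X)
    (φ : ℝ → X → X) (x : X) : ℝ≥0∞ :=
  ⨆ (ε : ℝ) (_ : 0 < ε), Filter.limsup (fun t : ℝ => localRate μ φ x ε t) Filter.atTop

/-- The set `G_μ(φ)` of generic points of `μ` for the flow `φ`. -/
def genericPts [TopologicalSpace X] [MeasurableSpace X] (φ : ℝ → X → X) (μ : Measure X) :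
    Set X :=
  {x : X | ∀ f : C(X, ℝ),
    Filter.Tendsto (fun t : ℝ => (1 / t) * ∫ τ in (0 : ℝ)..t, f (φ τ x))
      Filter.atTop (nhds (∫ y, f y ∂μ))}



section Dynamics

variable [MetricSpace X]

lemma IsFlow.continuous_time {φ : ℝ → X → X} (hφ : IsFlow φ) (x : X) :
    Continuous fun t => φ t x :=
  hφ.cont.comp (by fun_prop : Continuous fun t : ℝ => (t, x))

lemma IsFlow.continuous_space {φ : ℝ → X → X} (hφ : IsFlow φ) (t : ℝ) : Continuous (φ t) :=
  hφ.cont.comp (by fun_prop : Continuous fun x : X => (t, x))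

lemma IsFlow.map_nat_mul {φ : ℝ → X → X} (hφ : IsFlow φ) {r : ℝ} {x : X} (h : φ r x = x)
    (n : ℕ) : φ (n * r) x = x := by
  induction n with
  | zero => simpa using hφ.map_zero x
  | succ n ih =>
    have : ((n + 1 : ℕ) : ℝ) * r = n * r + r := by push_cast; ring
    rw [this, hφ.map_add, h, ih]

lemma IsFlow.map_neg_cancel {φ : ℝ → X → X} (hφ : IsFlow φ) (t : ℝ) (x : X) :
    φ (-t) (φ t x) = x := by
  rw [← hφ.map_add, neg_add_cancel, hφ.map_zero]

/-- Periods of a fixed point free flow on a compact space are bounded away from zero. -/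
lemma exists_pos_forall_ne [CompactSpace X] {φ : ℝ → X → X} (hφ : IsFlow φ)
    (hfp : FixedPointFree φ) : ∃ p > 0, ∀ r, 0 < r → r ≤ p → ∀ x, φ r x ≠ x := by
  by_contra! hcon
  choose r hr0 hr x hx using hcon
  let u : ℕ → ℝ := fun n => 1 / ((n : ℝ) + 1)
  have hu : ∀ n, 0 < u n := fun n => Nat.one_div_pos_of_nat
  have hulim : Tendsto u atTop (𝓝 0) := tendsto_one_div_add_atTop_nhds_zero_nat
  obtain ⟨a, -, ψ, hψ, hlim⟩ := isCompact_univ.tendsto_subseq (x := fun n => x (u n) (hu n))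
    (fun n => mem_univ _)
  have hrlim : Tendsto (fun n => r (u (ψ n)) (hu _)) atTop (𝓝 0) :=
    squeeze_zero (fun n => (hr0 _ (hu _)).le) (fun n => hr _ (hu _))
      (hulim.comp hψ.tendsto_atTop)
  have hpos : ∀ t : ℝ, 0 ≤ t → φ t a = a := by
    intro t ht
    have htime : Tendsto (fun n => (⌊t / r (u (ψ n)) (hu _)⌋₊ : ℝ) * r (u (ψ n)) (hu _)) atTop (𝓝 t) := by
      have h1 : Tendsto (fun n => t - r (u (ψ n)) (hu _)) atTop (𝓝 t) := by
        simpa using tendsto_const_nhds.sub hrlim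
      refine tendsto_of_tendsto_of_tendsto_of_le_of_le h1 tendsto_const_nhds ?_ ?_
      · intro n
        have hp := hr0 _ (hu (ψ n))
        have := (Nat.lt_floor_add_one (t / r (u (ψ n)) (hu _))).le
        rw [div_le_iff₀ hp] at this
        simp only
        linarith
      · intro n
        have hp := hr0 _ (hu (ψ n))
        have := Nat.floor_le (div_nonneg ht hp.le)
        rwa [le_div_iff₀ hp] at this
    have h2 := (hφ.cont.tendsto (t, a)).comp (htime.prodMk_nhds hlim)
    refine tendsto_nhds_unique h2 (hlim.congr fun n => ?_)
    exact (hφ.map_nat_mul (hx _ (hu _)) _).symm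
  obtain ⟨t, ht⟩ := hfp a
  rcases le_total 0 t with h | h
  · exact ht (hpos t h)
  · apply ht
    have := hφ.map_neg_cancel (-t) a
    rwa [hpos (-t) (by linarith), neg_neg] at this

/-- Short-time control of how far a shadowing time change can drift. -/
lemma exists_drift_le_of_le_one [CompactSpace X] {φ : ℝ → X → X} (hφ : IsFlow φ)
    (hfp : FixedPointFree φ) {c : ℝ} (hc : 0 < c) :
    ∃ ε > 0, ∀ (x y : X) (t : ℝ) (α : ℝ → ℝ), t ≤ 1 → ContinuousOn α (Icc 0 t) → α 0 = 0 →
      (∀ s ∈ Icc 0 t, dist (φ (α s) x) (φ s y) < ε) → ∀ s ∈ Icc 0 t, |α s - s| ≤ c := by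
  obtain ⟨p, hp, hne⟩ := exists_pos_forall_ne hφ hfp
  set k := min c p with hk
  have hk0 : 0 < k := lt_min hc hp
  obtain ⟨m, hm0, hm⟩ : ∃ m > 0, ∀ u : X, m ≤ dist (φ k u) u := by
    rcases isEmpty_or_nonempty X with h | h
    · exact ⟨1, one_pos, fun u => h.elim u⟩
    · obtain ⟨v, -, hv⟩ := isCompact_univ.exists_isMinOn (univ_nonempty (α := X))
        (f := fun u => dist (φ k u) u)
        ((hφ.continuous_space k).dist continuous_id).continuousOn
      exact ⟨dist (φ k v) v, dist_pos.2 (hne k hk0 (min_le_right _ _) v),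
        fun u => hv (mem_univ u)⟩
  have huc : UniformContinuousOn (fun q : ℝ × X => φ q.1 q.2) (Icc (0 : ℝ) 1 ×ˢ univ) :=
    (isCompact_Icc.prod isCompact_univ).uniformContinuousOn_of_continuous hφ.cont.continuousOn
  obtain ⟨ε, hε0, hε⟩ := Metric.uniformContinuousOn_iff.1 huc (m / 2) (by positivity)
  refine ⟨min ε (m / 2), lt_min hε0 (by positivity), ?_⟩
  intro x y t α ht hα hα0 hd s hs
  by_contra! hcon
  have hsub : Icc 0 s ⊆ Icc 0 t := Icc_subset_Icc_right hs.2
  have hcont : ContinuousOn (fun u => |α u - u|) (Icc 0 s) :=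
    ((hα.mono hsub).sub continuousOn_id).abs
  obtain ⟨u, hu, huk⟩ : k ∈ (fun u => |α u - u|) '' Icc 0 s := by
    apply intermediate_value_Icc hs.1 hcont
    simp only [hα0, sub_zero, abs_zero]
    exact ⟨hk0.le, (min_le_left _ _).trans hcon.le⟩
  simp only at huk
  have hxy : dist x y < ε := by
    have := hd 0 ⟨le_rfl, hs.1.trans hs.2⟩
    rw [hα0, hφ.map_zero, hφ.map_zero] at this
    exact this.trans_le (min_le_left _ _)
  have h1 : dist (φ u x) (φ u y) < m / 2 := by
    have hu1 : u ∈ Icc (0 : ℝ) 1 := ⟨hu.1, (hsub hu).2.trans ht⟩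
    exact hε (u, x) ⟨hu1, mem_univ _⟩ (u, y) ⟨hu1, mem_univ _⟩
      (by simpa [Prod.dist_eq, hε0] using hxy)
  have h2 : dist (φ (α u) x) (φ u y) < m / 2 := (hd u (hsub hu)).trans_le (min_le_right _ _)
  have h3 : dist (φ (α u) x) (φ u x) < m := by
    have := dist_triangle_right (φ (α u) x) (φ u x) (φ u y)
    linarith
  rcases abs_eq hk0.le |>.1 huk with h | h
  · have : α u = k + u := by linarith
    rw [this, hφ.map_add] at h3
    exact (hm _).not_gt h3
  · have : u = k + α u := by linarith
    have h4 : φ u x = φ k (φ (α u) x) := by rw [← hφ.map_add, ← this]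
    rw [h4, dist_comm] at h3
    exact (hm _).not_gt h3

/-- For a fixed point free flow, a time change along which two orbits stay close differs from
the identity by at most a small linear error. -/
lemma exists_drift_le [CompactSpace X] {φ : ℝ → X → X} (hφ : IsFlow φ)
    (hfp : FixedPointFree φ) {c : ℝ} (hc : 0 < c) :
    ∃ ε > 0, ∀ (x y : X) (t : ℝ) (α : ℝ → ℝ), ContinuousOn α (Icc 0 t) → α 0 = 0 →
      (∀ s ∈ Icc 0 t, dist (φ (α s) x) (φ s y) < ε) →
        ∀ s ∈ Icc 0 t, |α s - s| ≤ c * (s + 1) := by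
  obtain ⟨ε, hε0, hε⟩ := exists_drift_le_of_le_one hφ hfp hc
  refine ⟨ε, hε0, ?_⟩
  have key : ∀ n : ℕ, ∀ (x y : X) (t : ℝ) (α : ℝ → ℝ), ContinuousOn α (Icc 0 t) → α 0 = 0 →
      (∀ s ∈ Icc 0 t, dist (φ (α s) x) (φ s y) < ε) →
        ∀ s ∈ Icc 0 t, s ≤ n → |α s - s| ≤ c * n := by
    intro n
    induction n with
    | zero =>
      intro x y t α _ hα0 _ s hs hsn
      have : s = 0 := le_antisymm (by simpa using hsn) hs.1
      simp [this, hα0]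
    | succ n ih =>
      intro x y t α hα hα0 hd s hs hsn
      push_cast at hsn ⊢
      have hshort : ∀ u ∈ Icc 0 t, u ≤ 1 → |α u - u| ≤ c := by
        intro u hu hu1
        have hsub : Icc 0 u ⊆ Icc 0 t := Icc_subset_Icc_right hu.2
        exact hε x y u α hu1 (hα.mono hsub) hα0 (fun v hv => hd v (hsub hv)) u ⟨hu.1, le_rfl⟩
      rcases le_total s 1 with h1 | h1
      · have := hshort s hs h1
        have : 0 ≤ c * n := by positivity
        linarith
      · have hsub : ∀ v ∈ Icc 0 (t - 1), v + 1 ∈ Icc 0 t := fun v hv =>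
          ⟨by linarith [hv.1], by linarith [hv.2]⟩
        have h2 := ih (φ (α 1) x) (φ 1 y) (t - 1) (fun v => α (v + 1) - α 1)
          ((hα.comp (by fun_prop) hsub).sub continuousOn_const) (by simp)
          (fun v hv => by
            rw [← hφ.map_add, ← hφ.map_add, sub_add_cancel]
            exact hd _ (hsub v hv)) (s - 1) ⟨by linarith, by linarith [hs.2]⟩ (by linarith)
        have h3 := hshort 1 ⟨zero_le_one, h1.trans hs.2⟩ le_rfl
        simp only [sub_add_cancel] at h2
        have : α s - s = (α s - α 1 - (s - 1)) + (α 1 - 1) := by ring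
        rw [this]
        refine (abs_add_le _ _).trans ?_
        linarith
  intro x y t α hα hα0 hd s hs
  refine (key ⌈s⌉₊ x y t α hα hα0 hd s hs (Nat.le_ceil s)).trans ?_
  exact mul_le_mul_of_nonneg_left (Nat.ceil_lt_add_one hs.1).le hc.le

lemma reparBall_subset_of_le (φ : ℝ → X → X) (x : X) {t t' ε : ℝ} (h : t' ≤ t) :
    reparBall φ x t ε ⊆ reparBall φ x t' ε := by
  rintro y ⟨α, ⟨h1, h2, h3⟩, h4⟩
  have hsub : Icc 0 t' ⊆ Icc 0 t := Icc_subset_Icc_right h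
  exact ⟨α, ⟨h1.mono hsub, h2.mono hsub, h3⟩, fun s hs => h4 s (hsub hs)⟩

lemma reparBall_mono (φ : ℝ → X → X) (x : X) {t ε ε' : ℝ} (h : ε ≤ ε') :
    reparBall φ x t ε ⊆ reparBall φ x t ε' := by
  rintro y ⟨α, h1, h2⟩
  exact ⟨α, h1, fun s hs => (h2 s hs).trans_le h⟩

/-- Two points of a reparametrization ball are close to one another along a slightly shorter
stretch of orbit. -/
lemma exists_mem_reparBall_of_mem_of_mem [CompactSpace X] {φ : ℝ → X → X} (hφ : IsFlow φ)
    (hfp : FixedPointFree φ) {η : ℝ} (hη : 0 < η) (hη1 : η ≤ 1) :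
    ∃ ε₀ > 0, ∀ ε ≤ ε₀, ∀ (x y z : X) (t : ℝ), 1 ≤ t → y ∈ reparBall φ x t ε →
      z ∈ reparBall φ x t ε → z ∈ reparBall φ y ((1 - η) * t) (2 * ε) := by
  obtain ⟨ε₀, hε₀, hdrift⟩ := exists_drift_le hφ hfp (c := η / 4) (by positivity)
  refine ⟨ε₀, hε₀, ?_⟩
  rintro ε hε x y z t ht ⟨α, ⟨hα, hαi, hα0⟩, hαd⟩ ⟨β, ⟨hβ, hβi, hβ0⟩, hβd⟩
  have hDα := hdrift x y t α hα hα0 fun s hs => (hαd s hs).trans_le hε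
  have hDβ := hdrift x z t β hβ hβ0 fun s hs => (hβd s hs).trans_le hε
  have ht0 : (0 : ℝ) ≤ t := zero_le_one.trans ht
  have htt : t ∈ Icc 0 t := ⟨ht0, le_rfl⟩
  have hsub : Icc 0 ((1 - η) * t) ⊆ Icc 0 t := Icc_subset_Icc_right (by nlinarith)
  have hβmono : StrictMonoOn β (Icc 0 t) := by
    refine hβ.strictMonoOn_of_injOn_Icc ht0 ?_ hβi
    have := (abs_le.1 (hDβ t htt)).1
    rw [hβ0]
    nlinarith
  have hmem : ∀ s ∈ Icc 0 ((1 - η) * t), ∃ u ∈ Icc 0 t, α u = β s := by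
    intro s hs
    have hs' := hsub hs
    have h0 : β 0 ≤ β s := hβmono.monotoneOn ⟨le_rfl, ht0⟩ hs' hs.1
    have h1 := (abs_le.1 (hDβ s hs')).2
    have h2 := (abs_le.1 (hDα t htt)).1
    have h3 : β s ≤ α t := by
      have h4 : η * s ≤ η * t := mul_le_mul_of_nonneg_left hs'.2 hη.le
      have h5 : η * 1 ≤ η * t := mul_le_mul_of_nonneg_left ht hη.le
      linarith [hs.2]
    exact intermediate_value_Icc ht0 hα ⟨by rw [hα0, ← hβ0]; exact h0, h3⟩
  choose! γ hγ hγα using hmem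
  refine ⟨γ, ⟨?_, ?_, ?_⟩, ?_⟩
  · have hemb : IsClosedEmbedding ((Icc 0 t).domRestrict α) :=
      (continuousOn_iff_continuous_domRestrict.1 hα).isClosedEmbedding hαi.injective
    have hcont : Continuous fun s : Icc 0 ((1 - η) * t) => (⟨γ s, hγ s s.2⟩ : Icc 0 t) := by
      rw [hemb.continuous_iff]
      refine (continuousOn_iff_continuous_domRestrict.1 (hβ.mono hsub)).congr fun s => ?_
      exact (hγα s s.2).symm
    exact continuousOn_iff_continuous_domRestrict.2 (continuous_subtype_val.comp hcont)
  · intro a ha b hb hab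
    apply hβi (hsub ha) (hsub hb)
    rw [← hγα a ha, ← hγα b hb, hab]
  · by_cases h0 : (0 : ℝ) ∈ Icc 0 ((1 - η) * t)
    · exact hαi (hγ 0 h0) ⟨le_rfl, ht0⟩ (by rw [hγα 0 h0, hα0, hβ0])
    · exact absurd ⟨le_rfl, mul_nonneg (by linarith) ht0⟩ h0
  · intro s hs
    have h1 := hαd (γ s) (hγ s hs)
    have h2 := hβd s (hsub hs)
    rw [hγα s hs, dist_comm] at h1
    have := dist_triangle (φ (γ s) y) (φ (β s) x) (φ s z)
    linarith

lemma isOpen_reparBall {φ : ℝ → X → X} (hφ : IsFlow φ) (x : X) {t : ℝ} (ht : 0 ≤ t)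
    (ε : ℝ) : IsOpen (reparBall φ x t ε) := by
  rw [isOpen_iff_mem_nhds]
  rintro y ⟨α, hα, hd⟩
  have hcont : ContinuousOn (fun s => dist (φ (α s) x) (φ s y)) (Icc 0 t) :=
    continuous_dist.comp_continuousOn
      (((hφ.continuous_time x).comp_continuousOn hα.1).prodMk
        (hφ.continuous_time y).continuousOn)
  obtain ⟨u, hu, hmax⟩ := isCompact_Icc.exists_isMaxOn (nonempty_Icc.2 ht) hcont
  have hclose : ∀ᶠ z in 𝓝 y, ∀ s ∈ Icc 0 t,
      dist (φ s y) (φ s z) < ε - dist (φ (α u) x) (φ u y) := by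
    refine isCompact_Icc.eventually_forall_of_forall_eventually fun s hs => ?_
    have hc : Continuous fun p : X × ℝ => dist (φ p.2 y) (φ p.2 p.1) :=
      ((hφ.continuous_time y).comp continuous_snd).dist (hφ.cont.comp continuous_swap)
    refine hc.continuousAt.eventually_lt continuousAt_const ?_
    simpa using hd u hu
  filter_upwards [hclose] with z hz
  refine ⟨α, hα, fun s hs => ?_⟩
  have h1 := hmax hs
  have h2 := hz s hs
  have h3 := dist_triangle (φ (α s) x) (φ s y) (φ s z)
  simp only [mem_ofPred_eq] at h1
  linarith

end Dynamics

section Frostman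

/-- A Frostman-type lemma obtained from Hahn–Banach and Riesz–Markov–Kakutani: if every finite
weighted cover by the open sets `U i` costs at least `c`, then some probability measure is
dominated on each `U i` by the normalized cost. -/
lemma exists_isProbabilityMeasure_le_of_weighted_cover {Y ι : Type*} [TopologicalSpace Y]
    [T2Space Y] [CompactSpace Y] [Nonempty Y] [MeasurableSpace Y] [BorelSpace Y]
    {U : ι → Set Y} (hU : ∀ i, IsOpen (U i)) {b : ι → ℝ} (hb : ∀ i, 0 ≤ b i) {c : ℝ}
    (hc : 0 < c) (h : ∀ w : ι →₀ ℝ, (∀ i, 0 ≤ w i) →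
      (∀ x, 1 ≤ w.sum fun i a => a * (U i).indicator 1 x) → c ≤ w.sum fun i a => a * b i) :
    ∃ μ : Measure Y, IsProbabilityMeasure μ ∧ ∀ i, μ (U i) ≤ ENNReal.ofReal (b i / c) := by
  let D : (ι →₀ ℝ) → Y → ℝ := fun w x => w.sum fun i a => a * (b i / c - (U i).indicator 1 x)
  have hD_add : ∀ v w x, D (v + w) x = D v x + D w x := fun v w x =>
    Finsupp.sum_add_index' (fun i => zero_mul _) fun i a a' => add_mul _ _ _
  have hD_smul : ∀ (r : ℝ) w x, D (r • w) x = r * D w x := fun r w x => by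
    simp only [D]
    rw [Finsupp.sum_smul_index (fun i => zero_mul _), Finsupp.mul_sum]
    simp only [mul_assoc]
  have hD : ∀ w x, D w x = (w.sum fun i a => a * b i) / c -
      w.sum fun i a => a * (U i).indicator 1 x := fun w x => by
    simp only [D, Finsupp.sum, Finset.sum_div, ← Finset.sum_sub_distrib]
    refine Finset.sum_congr rfl fun i _ => ?_
    ring
  let C : PointedCone ℝ C(Y, ℝ) :=
    { carrier := {f | ∃ w : ι →₀ ℝ, (∀ i, 0 ≤ w i) ∧ ∀ x, D w x ≤ f x}
      zero_mem' := ⟨0, fun _ => le_rfl, fun x => by simp [D]⟩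
      add_mem' := by
        rintro f g ⟨v, hv, hvf⟩ ⟨w, hw, hwg⟩
        exact ⟨v + w, fun i => add_nonneg (hv i) (hw i), fun x => by
          rw [hD_add]; exact add_le_add (hvf x) (hwg x)⟩
      smul_mem' := by
        rintro ⟨r, hr⟩ f ⟨w, hw, hwf⟩
        exact ⟨r • w, fun i => mul_nonneg hr (hw i), fun x => by
          rw [hD_smul]; exact mul_le_mul_of_nonneg_left (hwf x) hr⟩ }
  have hone : (1 : C(Y, ℝ)) ≠ 0 := one_ne_zero
  obtain ⟨L, hL1, hLC⟩ := riesz_extension C (LinearPMap.mkSpanSingleton (1 : C(Y, ℝ)) (1 : ℝ) hone)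
    (by
      rintro ⟨f, hf⟩ ⟨w, hw, hwf⟩
      obtain ⟨a, rfl⟩ := Submodule.mem_span_singleton.1 hf
      rw [LinearPMap.mkSpanSingleton'_apply, RingHom.id_apply, smul_eq_mul, mul_one]
      by_contra! ha
      set cost := w.sum fun i a => a * b i with hcost
      have hlow : ∀ x, cost / c - a ≤ w.sum fun i a => a * (U i).indicator 1 x := fun x => by
        have := hwf x
        rw [hD] at this
        simp only [ContinuousMap.smul_apply, ContinuousMap.one_apply, smul_eq_mul,
          mul_one] at this
        linarith
      have hcost0 : 0 ≤ cost := Finset.sum_nonneg fun i _ => mul_nonneg (hw i) (hb i)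
      have hpos : 0 < cost / c - a := by
        have := div_nonneg hcost0 hc.le
        linarith
      have hle := h ((cost / c - a)⁻¹ • w) (fun i => mul_nonneg (inv_pos.2 hpos).le (hw i))
        (fun x => by
          rw [Finsupp.sum_smul_index (fun i => zero_mul _)]
          simp only [mul_assoc]
          rw [← Finsupp.mul_sum, inv_mul_eq_div, one_le_div hpos]
          exact hlow x)
      rw [Finsupp.sum_smul_index (fun i => zero_mul _)] at hle
      simp only [mul_assoc] at hle
      rw [← Finsupp.mul_sum, inv_mul_eq_div, le_div_iff₀ hpos, ← hcost, mul_sub,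
        mul_div_cancel₀ _ hc.ne'] at hle
      nlinarith)
    (by
      intro f
      refine ⟨⟨‖f‖ • 1, Submodule.mem_span_singleton.2 ⟨_, rfl⟩⟩, 0, fun _ => le_rfl, fun x => ?_⟩
      have hx : |f x| ≤ ‖f‖ := f.norm_coe_le_norm x
      have := neg_abs_le (f x)
      simp only [D, Finsupp.sum_zero_index, ContinuousMap.add_apply, ContinuousMap.smul_apply,
        ContinuousMap.one_apply, smul_eq_mul, mul_one]
      linarith)
  have hL_one : L 1 = 1 :=
    (hL1 ⟨1, Submodule.mem_span_singleton_self 1⟩).trans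
      (LinearPMap.mkSpanSingleton_apply ℝ ℝ hone 1)
  have hL_nonneg : ∀ f : C(Y, ℝ), (∀ x, 0 ≤ f x) → 0 ≤ L f := fun f hf =>
    hLC f ⟨0, fun _ => le_rfl, fun x => by simpa [D] using hf x⟩
  have hL_le : ∀ i, ∀ f : C(Y, ℝ), (∀ x, f x ≤ (U i).indicator 1 x) → L f ≤ b i / c := by
    intro i f hf
    have := hLC ((b i / c) • 1 - f) ⟨Finsupp.single i 1, fun j => by
      classical
      rw [Finsupp.single_apply]; split_ifs <;> norm_num, fun x => by
        have := hf x
        simp [D]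
        linarith⟩
    rw [map_sub, map_smul, hL_one] at this
    simpa using this
  let Λ : CompactlySupportedContinuousMap Y ℝ →ₚ[ℝ] ℝ := PositiveLinearMap.mk₀
    { toFun := fun f => L f.toContinuousMap
      map_add' := fun f g => L.map_add _ _
      map_smul' := fun r f => L.map_smul _ _ } fun f hf => hL_nonneg _ hf
  let e := CompactlySupportedContinuousMap.continuousMapEquiv (α := Y) (β := ℝ)
  have hΛ : ∀ f : C(Y, ℝ), Λ (e f) = L f := fun f => rfl
  let μ := RealRMK.rieszMeasure Λ
  have hμ : IsProbabilityMeasure μ := by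
    constructor
    apply le_antisymm
    · have := RealRMK.rieszMeasure_le_of_eq_one Λ (f := e 1) (fun x => zero_le_one)
        isCompact_univ (fun x _ => rfl)
      simpa [hΛ, hL_one] using this
    · have := RealRMK.le_rieszMeasure_tsupport_subset Λ (f := e 1)
        (fun x => ⟨zero_le_one, le_rfl⟩) (subset_univ _)
      simpa [hΛ, hL_one] using this
  have hreg : μ.Regular := RealRMK.regular_rieszMeasure Λ
  refine ⟨μ, hμ, fun i => ?_⟩
  rw [(hU i).measure_eq_iSup_isCompact]
  refine iSup₂_le fun F hF => iSup_le fun hFc => ?_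
  obtain ⟨f, hf1, hf0, -, hf⟩ := exists_continuous_one_zero_of_isCompact hFc
    (hU i).isClosed_compl (disjoint_compl_right_iff_subset.2 hF)
  refine (RealRMK.rieszMeasure_le_of_eq_one Λ (f := e f) (fun x => (hf x).1) hFc
    (fun x hx => hf1 hx)).trans (ENNReal.ofReal_le_ofReal ?_)
  rw [hΛ]
  refine hL_le i f fun x => ?_
  by_cases hx : x ∈ U i
  · simpa [hx] using (hf x).2
  · simpa [hx] using (hf0 hx).le

end Frostman

section Covers

/-- A maximal selection of points of `A`, no two of which share a member of the family `U`,
has cardinality controlled by the total weight. -/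
lemma exists_finset_separated {ι : Type*} (J : Finset ι) (U : ι → Set X)
    {w : ι → ℝ} (hw : ∀ i, 0 ≤ w i) {τ : ℝ} (hτ : 0 < τ) (A : Set X)
    (hA : ∀ x ∈ A, τ ≤ ∑ i ∈ J, w i * (U i).indicator 1 x) :
    ∃ Y : Finset X, (Y.card : ℝ) * τ ≤ ∑ i ∈ J, w i ∧
      ∀ x ∈ A, ∃ y ∈ Y, ∃ i ∈ J, x ∈ U i ∧ y ∈ U i := by
  classical
  let P : Finset X → Prop := fun Y => (∀ y ∈ Y, y ∈ A) ∧
    ∀ i ∈ J, ∀ y ∈ Y, ∀ z ∈ Y, y ∈ U i → z ∈ U i → y = z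
  have hcard : ∀ Y, P Y → (Y.card : ℝ) * τ ≤ ∑ i ∈ J, w i := by
    rintro Y ⟨hYA, hYU⟩
    calc (Y.card : ℝ) * τ = ∑ y ∈ Y, τ := by simp
      _ ≤ ∑ y ∈ Y, ∑ i ∈ J, w i * (U i).indicator 1 y :=
        Finset.sum_le_sum fun y hy => hA y (hYA y hy)
      _ = ∑ i ∈ J, w i * ∑ y ∈ Y, (U i).indicator 1 y := by
        rw [Finset.sum_comm]
        simp only [Finset.mul_sum]
      _ ≤ ∑ i ∈ J, w i := by
        refine Finset.sum_le_sum fun i hi => mul_le_of_le_one_right (hw i) ?_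
        have hone : ((Y.filter (· ∈ U i)).card : ℝ) ≤ 1 := by
          exact_mod_cast Finset.card_le_one.2 fun y hy z hz => by
            rw [Finset.mem_filter] at hy hz
            exact hYU i hi y hy.1 z hz.1 hy.2 hz.2
        simpa [Set.indicator_apply, Finset.sum_ite] using hone
  by_contra! hcon
  have hall : ∀ n : ℕ, ∃ Y, P Y ∧ Y.card = n := by
    intro n
    induction n with
    | zero => exact ⟨∅, ⟨by simp, by simp⟩, rfl⟩
    | succ n ih =>
      obtain ⟨Y, hY, hYn⟩ := ih
      obtain ⟨x, hxA, hx⟩ := hcon Y (hcard Y hY)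
      have hxY : x ∉ Y := by
        intro hxY
        have hzero : ∑ i ∈ J, w i * (U i).indicator 1 x = 0 :=
          Finset.sum_eq_zero fun i hi => by
            have : x ∉ U i := fun h => hx x hxY i hi h h
            simp [this]
        exact absurd (hA x hxA) (by rw [hzero]; exact hτ.not_ge)
      refine ⟨insert x Y, ⟨?_, ?_⟩, by rw [Finset.card_insert_of_notMem hxY, hYn]⟩
      · intro y hy
        rcases Finset.mem_insert.1 hy with rfl | hy
        · exact hxA
        · exact hY.1 y hy
      · intro i hi y hy z hz hyU hzU
        rcases Finset.mem_insert.1 hy with hyx | hyY <;>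
          rcases Finset.mem_insert.1 hz with hzx | hzY
        · rw [hyx, hzx]
        · exact absurd hzU (hx z hzY i hi (hyx ▸ hyU))
        · exact absurd hyU (hx y hyY i hi (hzx ▸ hzU))
        · exact hY.2 i hi y hyY z hzY hyU hzU
  obtain ⟨n, hn⟩ := exists_nat_gt ((∑ i ∈ J, w i) / τ)
  obtain ⟨Y, hY, rfl⟩ := hall n
  rw [div_lt_iff₀ hτ] at hn
  exact (hcard Y hY).not_gt hn

variable [MetricSpace X]

lemma coverM_le_sum (φ : ℝ → X → X) (Z : Set X) (s : ℝ) (N : ℕ) (ε : ℝ) {ι : Type*}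
    (G : Finset ι) (g : ι → X × ℝ) (hN : ∀ i ∈ G, (N : ℝ) ≤ (g i).2)
    (hZ : ∀ x ∈ Z, ∃ i ∈ G, x ∈ reparBall φ (g i).1 (g i).2 ε) :
    coverM φ Z s N ε ≤ ENNReal.ofReal (∑ i ∈ G, Real.exp (-s * (g i).2)) := by
  classical
  refine (iInf₂_le (↑(G.image g) : Set (X × ℝ)) (G.image g).countable_toSet).trans ?_
  refine (iInf₂_le ?_ ?_).trans ?_
  · simpa using hN
  · intro x hx
    obtain ⟨i, hi, hxi⟩ := hZ x hx
    exact mem_iUnion₂.2 ⟨g i, by simpa using ⟨i, hi, rfl⟩, hxi⟩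
  · rw [Finset.tsum_subtype' (G.image g) fun p : X × ℝ => ENNReal.ofReal (Real.exp (-s * p.2)),
      ENNReal.ofReal_sum_of_nonneg fun i _ => (Real.exp_pos _).le]
    exact Finset.sum_image_le_of_nonneg fun _ _ => zero_le

lemma coverM_anti_radius (φ : ℝ → X → X) (Z : Set X) (s : ℝ) (N : ℕ) {ε ε' : ℝ} (h : ε ≤ ε') :
    coverM φ Z s N ε' ≤ coverM φ Z s N ε := by
  refine le_iInf₂ fun F hF => le_iInf₂ fun hN hZ => ?_
  exact (iInf₂_le F hF).trans (iInf₂_le hN (hZ.trans (iUnion₂_mono fun p _ =>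
    reparBall_mono φ p.1 h)))

/-- Weighted covers are, up to a constant and a small loss in the exponent, no cheaper than
genuine covers. -/
lemma coverM_le_weighted_cost {φ : ℝ → X → X} {K : Set X} {η ε s s' δ : ℝ} {N N' : ℕ}
    (hη1 : η ≤ 1) (hs : 0 ≤ s) (hδ : 0 < δ) (hs' : s' * (1 - η) = s + δ)
    (hN : 1 ≤ N) (hN' : (N' : ℝ) ≤ (1 - η) * N)
    (hball : ∀ (x y z : X) (t : ℝ), 1 ≤ t → y ∈ reparBall φ x t ε →
      z ∈ reparBall φ x t ε → z ∈ reparBall φ y ((1 - η) * t) (2 * ε))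
    (w : {p : X × ℝ // (N : ℝ) ≤ p.2} →₀ ℝ) (hw : ∀ i, 0 ≤ w i)
    (hcov : ∀ x ∈ K, 1 ≤ w.sum fun i a => a * (reparBall φ i.1.1 i.1.2 ε).indicator 1 x) :
    coverM φ K s' N' (2 * ε) ≤ ENNReal.ofReal
      (Real.exp s / (1 - Real.exp (-δ)) * w.sum fun i a => a * Real.exp (-s * i.1.2)) := by
  classical
  set q := Real.exp (-δ) with hq
  have hq0 : 0 < q := Real.exp_pos _
  have hq1 : q < 1 := Real.exp_lt_one_iff.2 (by linarith)
  have h1q : 0 < 1 - q := by linarith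
  let fl : {p : X × ℝ // (N : ℝ) ≤ p.2} → ℕ := fun i => ⌊i.1.2⌋₊
  have hpos : ∀ i : {p : X × ℝ // (N : ℝ) ≤ p.2}, 0 ≤ i.1.2 := fun i =>
    (Nat.cast_nonneg N).trans i.2
  let J : ℕ → Finset {p : X × ℝ // (N : ℝ) ≤ p.2} := fun n => w.support.filter fun i => fl i = n
  let T : Finset ℕ := w.support.image fl
  have hmaps : ∀ i ∈ w.support, fl i ∈ T := fun i hi => Finset.mem_image_of_mem _ hi
  let B : {p : X × ℝ // (N : ℝ) ≤ p.2} → Set X := fun i => reparBall φ i.1.1 i.1.2 ε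
  have hsel := fun n : ℕ => exists_finset_separated (J n) B hw (τ := (1 - q) * q ^ n)
    (by positivity) {x | x ∈ K ∧ (1 - q) * q ^ n ≤ ∑ i ∈ J n, w i * (B i).indicator 1 x}
    (fun x hx => hx.2)
  choose Y hYcard hYcov using hsel
  have hgeom : ∑ n ∈ T, (1 - q) * q ^ n ≤ 1 := by
    rw [← Finset.mul_sum, ← le_div_iff₀' h1q, one_div, ← tsum_geometric_of_lt_one hq0.le hq1]
    exact (summable_geometric_of_lt_one hq0.le hq1).sum_le_tsum _ fun n _ => by positivity
  have hlevel : ∀ x ∈ K, ∃ n ∈ T, (1 - q) * q ^ n ≤ ∑ i ∈ J n, w i * (B i).indicator 1 x := by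
    intro x hx
    have h1 := hcov x hx
    rw [Finsupp.sum, ← Finset.sum_fiberwise_of_maps_to hmaps] at h1
    rcases T.eq_empty_or_nonempty with hT | hT
    · rw [hT, Finset.sum_empty] at h1
      exact absurd h1 (by norm_num)
    · exact Finset.exists_le_of_sum_le hT (hgeom.trans h1)
  refine (coverM_le_sum φ K s' N' (2 * ε) (T.sigma Y) (fun p => (p.2, (1 - η) * p.1))
    ?_ ?_).trans (ENNReal.ofReal_le_ofReal ?_)
  · rintro ⟨n, y⟩ hp
    obtain ⟨hn, -⟩ := Finset.mem_sigma.1 hp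
    obtain ⟨i, -, hi⟩ := Finset.mem_image.1 hn
    refine hN'.trans (mul_le_mul_of_nonneg_left ?_ (by linarith))
    have : N ≤ n := by
      change fl i = n at hi
      rw [← hi]
      exact Nat.le_floor i.2
    exact_mod_cast this
  · intro x hx
    obtain ⟨n, hn, hle⟩ := hlevel x hx
    obtain ⟨y, hy, i, hi, hxi, hyi⟩ := hYcov n x ⟨hx, hle⟩
    refine ⟨⟨n, y⟩, Finset.mem_sigma.2 ⟨hn, hy⟩, ?_⟩
    have hone : (1 : ℝ) ≤ i.1.2 := le_trans (by exact_mod_cast hN) i.2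
    refine reparBall_subset_of_le φ y ?_ (hball i.1.1 y x i.1.2 hone hyi hxi)
    refine mul_le_mul_of_nonneg_left ?_ (by linarith)
    rw [← (Finset.mem_filter.1 hi).2]
    exact Nat.floor_le (hpos i)
  · rw [Finset.sum_sigma]
    calc ∑ n ∈ T, ∑ y ∈ Y n, Real.exp (-s' * ((1 - η) * n))
        = ∑ n ∈ T, ((Y n).card * ((1 - q) * q ^ n)) * (Real.exp (-s * n) / (1 - q)) := by
          refine Finset.sum_congr rfl fun n _ => ?_
          have : Real.exp (-s' * ((1 - η) * n)) = Real.exp (-s * n) * q ^ n := by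
            rw [hq, ← Real.exp_nat_mul, ← Real.exp_add]
            congr 1
            linear_combination (-(n : ℝ)) * hs'
          rw [this, Finset.sum_const, nsmul_eq_mul]
          field_simp
      _ ≤ ∑ n ∈ T, (∑ i ∈ J n, w i) * (Real.exp (-s * n) / (1 - q)) :=
          Finset.sum_le_sum fun n _ => mul_le_mul_of_nonneg_right (hYcard n) (by positivity)
      _ = ∑ n ∈ T, ∑ i ∈ J n, w i * (Real.exp (-s * fl i) / (1 - q)) := by
          refine Finset.sum_congr rfl fun n _ => ?_
          rw [Finset.sum_mul]
          refine Finset.sum_congr rfl fun i hi => ?_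
          rw [(Finset.mem_filter.1 hi).2]
      _ = ∑ i ∈ w.support, w i * (Real.exp (-s * fl i) / (1 - q)) :=
          Finset.sum_fiberwise_of_maps_to hmaps _
      _ ≤ ∑ i ∈ w.support, Real.exp s / (1 - q) * (w i * Real.exp (-s * i.1.2)) := by
          refine Finset.sum_le_sum fun i _ => ?_
          have hfl : i.1.2 ≤ fl i + 1 := (Nat.lt_floor_add_one i.1.2).le
          have hexp : Real.exp (-s * fl i) ≤ Real.exp s * Real.exp (-s * i.1.2) := by
            rw [← Real.exp_add]
            exact Real.exp_le_exp.2 (by nlinarith)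
          calc w i * (Real.exp (-s * fl i) / (1 - q))
              ≤ w i * (Real.exp s * Real.exp (-s * i.1.2) / (1 - q)) := by
                gcongr
                exact hw i
            _ = _ := by ring
      _ = _ := by rw [Finsupp.sum, Finset.mul_sum]

end Covers

section VariationalPrinciple

lemma le_negLogNN {a : ℝ≥0∞} (ha : a ≤ 1) {r : ℝ} : ENNReal.ofReal r ≤ negLogNN a ↔
    r ≤ 0 ∨ a ≤ ENNReal.ofReal (Real.exp (-r)) := by
  unfold negLogNN
  split_ifs with h
  · simp [h]
  · have hpos : 0 < a.toReal := ENNReal.toReal_pos h (ha.trans_lt ENNReal.one_lt_top).ne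
    rw [ENNReal.le_ofReal_iff_toReal_le (ha.trans_lt ENNReal.one_lt_top).ne (Real.exp_pos _).le,
      ← Real.log_le_iff_le_exp hpos]
    rcases le_or_gt r 0 with hr | hr
    · simp [hr, ENNReal.ofReal_of_nonpos hr]
    · have hle : a.toReal ≤ 1 := ENNReal.toReal_le_of_le_ofReal zero_le_one (by simpa using ha)
      rw [ENNReal.ofReal_le_ofReal_iff (neg_nonneg.2 (Real.log_nonpos hpos.le hle))]
      constructor
      · exact fun h => Or.inr (by linarith)
      · rintro (h | h) <;> linarith

variable [MetricSpace X] [MeasurableSpace X]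

lemma ofReal_le_localRate_iff {ν : Measure X} [IsProbabilityMeasure ν] {φ : ℝ → X → X} {x : X}
    {ε t s : ℝ} (ht : 0 < t) (hs : 0 < s) : ENNReal.ofReal s ≤ localRate ν φ x ε t ↔
      ν (reparBall φ x t ε) ≤ ENNReal.ofReal (Real.exp (-s * t)) := by
  have ht' : ENNReal.ofReal t ≠ 0 := by simpa using ht
  rw [localRate, ENNReal.le_div_iff_mul_le (Or.inl ht') (Or.inl ENNReal.ofReal_ne_top),
    ← ENNReal.ofReal_mul hs.le, le_negLogNN prob_le_one, neg_mul]
  have : ¬ s * t ≤ 0 := (mul_pos hs ht).not_ge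
  simp [this]

lemma ofReal_le_lowerLocalEnt {φ : ℝ → X → X} {ν : Measure X} [IsProbabilityMeasure ν] {x : X}
    {ε s r c : ℝ} {N : ℕ} (hε : 0 < ε) (hr : 0 < r) (hrs : r < s) (hc : 0 < c)
    (h : ∀ t, (N : ℝ) ≤ t →
      ν (reparBall φ x t ε) ≤ ENNReal.ofReal (Real.exp (-s * t) / c)) :
    ENNReal.ofReal r ≤ lowerLocalEnt ν φ x := by
  refine le_trans ?_ (le_iSup₂ (f := fun ε (_ : 0 < ε) =>
    liminf (fun t : ℝ => localRate ν φ x ε t) atTop) ε hε)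
  refine le_liminf_of_le (h := ?_)
  filter_upwards [eventually_ge_atTop (N : ℝ), eventually_gt_atTop 0,
    eventually_ge_atTop (-Real.log c / (s - r))] with t htN ht0 htc
  refine (ofReal_le_localRate_iff ht0 hr).2 ((h t htN).trans (ENNReal.ofReal_le_ofReal ?_))
  rw [div_le_iff₀ (by linarith)] at htc
  rw [div_le_iff₀ hc]
  nth_rewrite 1 [← Real.exp_log hc]
  rw [← Real.exp_add]
  exact Real.exp_le_exp.2 (by linarith)

variable [CompactSpace X]

/-- Mass distribution principle for reparametrization balls. -/
lemma measure_eq_zero_of_coverMlim_eq_zero {φ : ℝ → X → X} (hφ : IsFlow φ)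
    (hfp : FixedPointFree φ) {K A : Set X} (hAK : A ⊆ K) (ν : Measure X) {s r ε : ℝ} {N : ℕ}
    (hs : 0 ≤ s) (hr : s < r) (hε : 0 < ε)
    (hA : ∀ x ∈ A, ∀ t, (N : ℝ) ≤ t →
      ν (reparBall φ x t ε) ≤ ENNReal.ofReal (Real.exp (-r * t)))
    (hK : coverMlim φ K s = 0) : ν A = 0 := by
  have hr0 : 0 < r := hs.trans_lt hr
  set η := (r - s) / (2 * r) with hη
  have hη0 : 0 < η := div_pos (by linarith) (by linarith)
  have hη1 : η ≤ 1 / 2 := by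
    rw [hη, div_le_div_iff₀ (by linarith) (by norm_num)]
    linarith
  have hηr : s ≤ r * (1 - η) := by
    have : r * η = (r - s) / 2 := by rw [hη]; field_simp
    linarith
  obtain ⟨ε₀, hε₀, hball⟩ := exists_mem_reparBall_of_mem_of_mem hφ hfp hη0 (by linarith)
  set ε' := min ε₀ (ε / 2) with hε'
  have hε'0 : 0 < ε' := lt_min hε₀ (by linarith)
  have hzero : coverM φ K s (2 * N + 1) ε' = 0 := by
    refine le_antisymm ?_ zero_le
    rw [← hK]
    exact (le_iSup (fun n => coverM φ K s n ε') (2 * N + 1)).trans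
      (le_iSup₂ (f := fun ε (_ : 0 < ε) => coverMeps φ K s ε) ε' hε'0)
  refine le_antisymm ?_ zero_le
  rw [← hzero]
  refine le_iInf₂ fun F hF => le_iInf₂ fun hN hcov => ?_
  have : Countable F := hF.to_subtype
  calc ν A ≤ ν (⋃ p : F, A ∩ reparBall φ p.1.1 p.1.2 ε') := by
        refine measure_mono fun x hx => ?_
        obtain ⟨p, hp, hxp⟩ := mem_iUnion₂.1 (hcov (hAK hx))
        exact mem_iUnion.2 ⟨⟨p, hp⟩, hx, hxp⟩
    _ ≤ ∑' p : F, ν (A ∩ reparBall φ p.1.1 p.1.2 ε') := measure_iUnion_le _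
    _ ≤ _ := ENNReal.tsum_le_tsum fun p => ?_
  rcases (A ∩ reparBall φ p.1.1 p.1.2 ε').eq_empty_or_nonempty with h | ⟨y, hyA, hy⟩
  · rw [h, measure_empty]
    exact zero_le
  · have hp := hN p.1 p.2
    push_cast at hp
    have hN0 : (0 : ℝ) ≤ N := Nat.cast_nonneg N
    have ht : (N : ℝ) ≤ (1 - η) * p.1.2 := by nlinarith
    calc ν (A ∩ reparBall φ p.1.1 p.1.2 ε')
        ≤ ν (reparBall φ y ((1 - η) * p.1.2) ε) := by
          refine measure_mono fun z hz => reparBall_mono φ y ?_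
            (hball ε' (min_le_left _ _) p.1.1 y z p.1.2 (by linarith) hy hz.2)
          have := min_le_right ε₀ (ε / 2)
          linarith
      _ ≤ ENNReal.ofReal (Real.exp (-r * ((1 - η) * p.1.2))) := hA y hyA _ ht
      _ ≤ _ := by
          refine ENNReal.ofReal_le_ofReal (Real.exp_le_exp.2 ?_)
          have : s * p.1.2 ≤ r * (1 - η) * p.1.2 :=
            mul_le_mul_of_nonneg_right hηr (by linarith)
          linarith

lemma lintegral_lowerLocalEnt_le_bowenEntropy [BorelSpace X] {φ : ℝ → X → X} (hφ : IsFlow φ)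
    (hfp : FixedPointFree φ) {K : Set X} (hK : IsCompact K) (ν : Measure X)
    [IsProbabilityMeasure ν] (hν : ν K = 1) :
    ∫⁻ x, lowerLocalEnt ν φ x ∂ν ≤ bowenEntropy φ K := by
  refine le_iInf fun s => le_iInf₂ fun hs hsK => ?_
  let A : ℕ → ℕ → ℕ → Set X := fun j k N => {x | x ∈ K ∧ ∀ t, (N : ℝ) ≤ t →
    ν (reparBall φ x t (1 / ((k : ℝ) + 1))) ≤
      ENNReal.ofReal (Real.exp (-(s + 1 / ((j : ℝ) + 1)) * t))}
  have hA : ∀ j k N, ν (A j k N) = 0 := fun j k N =>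
    measure_eq_zero_of_coverMlim_eq_zero hφ hfp (fun x hx => hx.1) ν hs
      (lt_add_of_pos_right s Nat.one_div_pos_of_nat) Nat.one_div_pos_of_nat
      (fun x hx => hx.2) hsK
  have hall : ∀ᵐ x ∂ν, ∀ j k N, x ∉ A j k N := by
    simp only [ae_all_iff]
    exact fun j k N => measure_eq_zero_iff_ae_notMem.1 (hA j k N)
  have hKae : ∀ᵐ x ∂ν, x ∈ K := (prob_compl_eq_zero_iff hK.measurableSet).2 hν
  have hle : ∀ᵐ x ∂ν, lowerLocalEnt ν φ x ≤ ENNReal.ofReal s := by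
    filter_upwards [hall, hKae] with x hx hxK
    by_contra! hlt
    obtain ⟨ε, hlt⟩ := lt_iSup_iff.1 hlt
    obtain ⟨hε, hlt⟩ := lt_iSup_iff.1 hlt
    obtain ⟨r, hr0, hsr, hr⟩ := ENNReal.lt_iff_exists_real_btwn.1 hlt
    have hsr' : s < r := (ENNReal.ofReal_lt_ofReal_iff_of_nonneg hs).1 hsr
    obtain ⟨j, hj⟩ := exists_nat_one_div_lt (sub_pos.2 hsr')
    obtain ⟨k, hk⟩ := exists_nat_one_div_lt hε
    obtain ⟨T, hT⟩ := eventually_atTop.1 (eventually_lt_of_lt_liminf hr)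
    obtain ⟨N, hN⟩ := exists_nat_gt (max T 0)
    refine hx j k N ⟨hxK, fun t ht => ?_⟩
    have htT : T ≤ t := (le_max_left _ _).trans (hN.le.trans ht)
    have ht0 : 0 < t := ((le_max_right _ _).trans_lt hN).trans_le ht
    refine (measure_mono (reparBall_mono φ x hk.le)).trans ?_
    refine ((ofReal_le_localRate_iff ht0 (hs.trans_lt hsr')).1 (hT t htT).le).trans ?_
    refine ENNReal.ofReal_le_ofReal (Real.exp_le_exp.2 ?_)
    nlinarith
  calc ∫⁻ x, lowerLocalEnt ν φ x ∂ν ≤ ∫⁻ _, ENNReal.ofReal s ∂ν := lintegral_mono_ae hle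
    _ = ENNReal.ofReal s := by simp

/-- Below the Bowen entropy there is a measure on `K` all of whose balls have exponentially
small mass. -/
lemma exists_measure_reparBall_le [BorelSpace X] {φ : ℝ → X → X} (hφ : IsFlow φ)
    (hfp : FixedPointFree φ) {K : Set X} (hne : K.Nonempty) (hK : IsCompact K) {s s' : ℝ}
    (hs : 0 ≤ s) (hss' : s < s') (hpos : coverMlim φ K s' ≠ 0) :
    ∃ ν : Measure X, IsProbabilityMeasure ν ∧ ν K = 1 ∧ ∃ ε > 0, ∃ N : ℕ, ∃ c > 0,
      ∀ x t, (N : ℝ) ≤ t → ν (reparBall φ x t ε) ≤ ENNReal.ofReal (Real.exp (-s * t) / c) := by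
  have hs'0 : 0 < s' := hs.trans_lt hss'
  set η := (s' - s) / (2 * s') with hη
  set δ := (s' - s) / 2 with hδ
  have hη0 : 0 < η := div_pos (by linarith) (by linarith)
  have hη1 : η ≤ 1 / 2 := by
    rw [hη, div_le_div_iff₀ (by linarith) (by norm_num)]
    linarith
  have hηs : s' * (1 - η) = s + δ := by
    have : s' * η = δ := by rw [hη]; field_simp; linarith
    linarith
  have hδ0 : 0 < δ := by linarith
  obtain ⟨ε₀, hε₀, hball⟩ := exists_mem_reparBall_of_mem_of_mem hφ hfp hη0 (by linarith)
  obtain ⟨ε₁, hpos⟩ := lt_iSup_iff.1 (pos_iff_ne_zero.2 hpos)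
  obtain ⟨hε₁, hpos⟩ := lt_iSup_iff.1 hpos
  obtain ⟨N', hpos⟩ := lt_iSup_iff.1 hpos
  set ε := min ε₀ (ε₁ / 2) with hε
  have hε0 : 0 < ε := lt_min hε₀ (by linarith)
  have hε2 : 2 * ε ≤ ε₁ := by
    have := min_le_right ε₀ (ε₁ / 2)
    linarith
  replace hpos : 0 < coverM φ K s' N' (2 * ε) :=
    hpos.trans_le (coverM_anti_radius φ K s' N' hε2)
  obtain ⟨m, hm0, hm⟩ : ∃ m : ℝ, 0 < m ∧ ENNReal.ofReal m < coverM φ K s' N' (2 * ε) := by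
    obtain ⟨m, -, h1, h2⟩ := ENNReal.lt_iff_exists_real_btwn.1 hpos
    exact ⟨m, ENNReal.ofReal_pos.1 h1, h2⟩
  have h1q : 0 < 1 - Real.exp (-δ) := by
    have : Real.exp (-δ) < 1 := Real.exp_lt_one_iff.2 (by linarith)
    linarith
  set D := Real.exp s / (1 - Real.exp (-δ)) with hD
  have hD0 : 0 < D := div_pos (Real.exp_pos _) h1q
  set N := 2 * N' + 1 with hN
  have : CompactSpace K := isCompact_iff_compactSpace.1 hK
  have : Nonempty K := hne.to_subtype
  have hopen : ∀ i : {p : X × ℝ // (N : ℝ) ≤ p.2}, IsOpen (reparBall φ i.1.1 i.1.2 ε) := fun i =>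
    isOpen_reparBall hφ _ ((Nat.cast_nonneg N).trans i.2) ε
  obtain ⟨μ, hμ, hμU⟩ := exists_isProbabilityMeasure_le_of_weighted_cover (Y := K)
    (U := fun i : {p : X × ℝ // (N : ℝ) ≤ p.2} =>
      ((↑) : K → X) ⁻¹' reparBall φ i.1.1 i.1.2 ε)
    (fun i => (hopen i).preimage continuous_subtype_val)
    (b := fun i => Real.exp (-s * i.1.2)) (fun i => (Real.exp_pos _).le)
    (c := m / D) (div_pos hm0 hD0) (fun w hw hcov => by
      have hle := coverM_le_weighted_cost (K := K) (N' := N') (by linarith) hs hδ0 hηs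
        (by omega : 1 ≤ N)
        (by
          rw [hN]; push_cast
          have : (0 : ℝ) ≤ N' := Nat.cast_nonneg N'
          nlinarith)
        (hball ε (min_le_left _ _)) w hw (fun x hx => hcov ⟨x, hx⟩)
      have := (ENNReal.ofReal_lt_ofReal_iff_of_nonneg hm0.le).1 (hm.trans_le hle)
      rw [div_le_iff₀' hD0]
      exact this.le)
  have hmap : ∀ S : Set X, MeasurableSet S →
      μ.map ((↑) : K → X) S = μ (((↑) : K → X) ⁻¹' S) := fun S hS =>
    Measure.map_apply measurable_subtype_coe hS
  refine ⟨μ.map (↑), Measure.isProbabilityMeasure_map measurable_subtype_coe.aemeasurable, ?_,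
    ε, hε0, N, m / D, div_pos hm0 hD0, fun x t ht => ?_⟩
  · rw [hmap K hK.measurableSet]
    simp
  · rw [hmap _ (hopen ⟨(x, t), ht⟩).measurableSet]
    exact hμU ⟨(x, t), ht⟩

end VariationalPrinciple

/-- **Variational principle for Bowen entropy of flows.** For a nonempty compact
`K ⊆ X`, the Bowen entropy of `K` equals the supremum of `∫ underline h_μ(φ,·) dμ` over
Borel probability measures `μ` with `μ(K) = 1`. -/
theorem bowenEntropy_variational_principle {X : Type*} [MetricSpace X] [CompactSpace X]
    [MeasurableSpace X] [BorelSpace X] (φ : ℝ → X → X) (hφ : IsFlow φ)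
    (hfp : FixedPointFree φ) (K : Set X) (hne : K.Nonempty) (hK : IsCompact K) :
    bowenEntropy φ K =
      ⨆ (ν : Measure X) (_ : IsProbabilityMeasure ν) (_ : ν K = 1),
        ∫⁻ x, lowerLocalEnt ν φ x ∂ν := by
  apply le_antisymm
  · refine le_of_forall_lt fun a ha => ?_
    obtain ⟨r, hr0, har, hr⟩ := ENNReal.lt_iff_exists_real_btwn.1 ha
    obtain ⟨u, hu0, hru, hu⟩ := ENNReal.lt_iff_exists_real_btwn.1 hr
    have hrpos : 0 < r := ENNReal.ofReal_pos.1 (pos_of_gt har)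
    have hru' : r < u := (ENNReal.ofReal_lt_ofReal_iff_of_nonneg hr0).1 hru
    have hpos : coverMlim φ K u ≠ 0 := fun h =>
      hu.not_ge ((iInf₂_le u hu0).trans (iInf_le _ h))
    obtain ⟨ν, hν, hνK, ε, hε, N, c, hc, hball⟩ := exists_measure_reparBall_le hφ hfp hne hK
      (s := (r + u) / 2) (by linarith) (by linarith) hpos
    have hent : ENNReal.ofReal r ≤ ∫⁻ x, lowerLocalEnt ν φ x ∂ν := by
      calc ENNReal.ofReal r = ∫⁻ _, ENNReal.ofReal r ∂ν := by simp
        _ ≤ _ := lintegral_mono fun x =>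
          ofReal_le_lowerLocalEnt hε hrpos (by linarith) hc (hball x)
    refine har.trans_le (hent.trans ?_)
    exact le_iSup₂_of_le ν hν (le_iSup_of_le hνK le_rfl)
  · exact iSup₂_le fun ν hν => iSup_le fun hνK =>
      lintegral_lowerLocalEnt_le_bowenEntropy hφ hfp hK ν hνK

end FlowEntropy
end

section
/- (Vitali-type covering lemma for reparametrization balls.) Let (X,d) be a compact metric space and φ a continuous flow on X without fixed points. Let 0<η<1 and let θ>0 be a constant (depending on η) such that d(φ_{α(s)}x, φ_s y)<θ for all s in a closed interval I containing 0 implies |α(s)−s|<η|s| for |s|>1 and |α(s)−s|<η for |s|≤1, for every reparametrization α∈Rep(I). Let ℬ={B(x,t,r,φ)}_{(x,t)∈I} be a family of reparametrization balls with 0<r<θ/2 and t>1/(1−η)² for all members. Then there exists a finite or countable subfamily ℬ'={B(x,t,r,φ)}_{(x,t)∈I'} (I'⊂I) of pairwise disjoint balls in ℬ such that ∪_{B∈ℬ} B ⊂ ∪_{(x,t)∈I'} B(x, t̂, 5r, φ), where t̂=(1−η)²t. -/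
open MeasureTheory Filter Set Topology
open scoped ENNReal NNReal

namespace FlowEntropy

variable {X : Type*}

/-- The inverse of a continuous injective function on a compact set is continuous. -/
theorem continuousOn_invFunOn_image {α β : Type*} [TopologicalSpace α] [Nonempty α]
    [TopologicalSpace β] [T2Space β] {f : α → β} {K : Set α} (hK : IsCompact K)
    (hf : ContinuousOn f K) (hinj : InjOn f K) :
    ContinuousOn (Function.invFunOn f K) (f '' K) := by
  rw [continuousOn_iff_isClosed]
  intro C hC
  refine ⟨f '' (K ∩ C), ((hK.inter_right hC).image_of_continuousOn
    (hf.mono inter_subset_left)).isClosed, ?_⟩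
  ext y
  constructor
  · rintro ⟨hyC, x, hx, rfl⟩
    rw [mem_preimage, hinj.leftInvOn_invFunOn hx] at hyC
    exact ⟨⟨x, ⟨hx, hyC⟩, rfl⟩, x, hx, rfl⟩
  · rintro ⟨⟨x, ⟨hx, hxC⟩, rfl⟩, -⟩
    refine ⟨?_, x, hx, rfl⟩
    rwa [mem_preimage, hinj.leftInvOn_invFunOn hx]

theorem IsReparOn.mono {α : ℝ → ℝ} {J K : Set ℝ} (h : IsReparOn α K) (hJK : J ⊆ K) :
    IsReparOn α J :=
  ⟨h.1.mono hJK, h.2.1.mono hJK, h.2.2⟩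

/-- A reparametrization of `[0, t]` that is positive at `t` is strictly increasing. -/
theorem IsReparOn.strictMonoOn {α : ℝ → ℝ} {t : ℝ} (h : IsReparOn α (Icc 0 t)) (ht : 0 ≤ t)
    (hpos : 0 < α t) : StrictMonoOn α (Icc 0 t) :=
  h.1.strictMonoOn_of_injOn_Icc ht (by rw [h.2.2]; exact hpos.le) h.2.1

/-- If `β` covers the range of `γ`, then `α ∘ β⁻¹ ∘ γ` is a reparametrization. -/
theorem IsReparOn.comp_invFunOn_comp {α β γ : ℝ → ℝ} {J K : Set ℝ} (hK : IsCompact K)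
    (h0 : 0 ∈ K) (hα : IsReparOn α K) (hβ : IsReparOn β K) (hγ : IsReparOn γ J)
    (hmaps : MapsTo γ J (β '' K)) :
    IsReparOn (fun s => α (Function.invFunOn β K (γ s))) J := by
  have hinv : MapsTo (Function.invFunOn β K) (β '' K) K := fun y hy =>
    Function.invFunOn_mem hy
  have hinvinj : InjOn (Function.invFunOn β K) (β '' K) := fun y hy z hz h => by
    rw [← Function.invFunOn_eq hy, ← Function.invFunOn_eq hz, h]
  refine ⟨hα.1.comp ((continuousOn_invFunOn_image hK hβ.1 hβ.2.1).comp hγ.1 hmaps)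
    (hinv.comp hmaps), hα.2.1.comp (hinvinj.comp hγ.2.1 hmaps) (hinv.comp hmaps), ?_⟩
  have : Function.invFunOn β K 0 = 0 := by
    simpa only [hβ.2.2] using hβ.2.1.leftInvOn_invFunOn h0
  simp only [hγ.2.2, this, hα.2.2]

theorem reparBall_mem_nhds [PseudoMetricSpace X] {φ : ℝ → X → X} (hφ : IsFlow φ) (x : X)
    (t : ℝ) {r : ℝ} (hr : 0 < r) : reparBall φ x t r ∈ 𝓝 x := by
  have key : ∀ᶠ y in 𝓝 x, ∀ s ∈ Icc (0 : ℝ) t, dist (φ s x) (φ s y) < r := by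
    refine isCompact_Icc.eventually_forall_of_forall_eventually fun s _ => ?_
    have hc : Continuous fun p : X × ℝ => dist (φ p.2 x) (φ p.2 p.1) :=
      (hφ.cont.comp (continuous_snd.prodMk continuous_const)).dist
        (hφ.cont.comp (continuous_snd.prodMk continuous_fst))
    exact hc.continuousAt.eventually_lt continuousAt_const (by simpa using hr)
  filter_upwards [key] with y hy
  exact ⟨id, ⟨continuousOn_id, injOn_id _, rfl⟩, hy⟩

/-- If two reparametrization balls intersect and the time of the second is not much shorter
than that of the first, then the second is contained in an enlargement of the first, provided
that reparametrizations distort times longer than one by a factor of at most `η`. -/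
theorem reparBall_subset_of_inter_nonempty [PseudoMetricSpace X] {φ : ℝ → X → X} {η r : ℝ}
    (hη0 : 0 < η) (hη1 : η < 1)
    (hdist : ∀ x y : X, ∀ b : ℝ, 0 ≤ b → ∀ α : ℝ → ℝ, IsReparOn α (Icc 0 b) →
      (∀ s ∈ Icc 0 b, dist (φ (α s) x) (φ s y) < r) →
      ∀ s ∈ Icc 0 b, 1 < s → |α s - s| < η * s)
    {x y : X} {t t' : ℝ} (ht : 1 < (1 - η) ^ 2 * t) (ht' : 1 < t')
    (htt' : (1 - η ^ 2) * t ≤ t')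
    (hne : (reparBall φ x t r ∩ reparBall φ y t' r).Nonempty) :
    reparBall φ y t' r ⊆ reparBall φ x ((1 - η) ^ 2 * t) (3 * r) := by
  obtain ⟨z, ⟨α, hα, hαd⟩, β, hβ, hβd⟩ := hne
  rintro w ⟨γ, hγ, hγd⟩
  set T := (1 - η) ^ 2 * t with hT
  have ht0 : 0 < t := by
    by_contra! h
    nlinarith [sq_nonneg (1 - η)]
  have hTt : T ≤ t := by
    rw [hT]
    exact mul_le_of_le_one_left ht0.le (pow_le_one₀ (by linarith) (by linarith))
  have hTt' : T ≤ t' := by rw [hT]; nlinarith [mul_pos (mul_pos hη0 (sub_pos.2 hη1)) ht0]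
  set m := min t t' with hm
  have hm1 : 1 < m := lt_min (ht.trans_le hTt) ht'
  have hmc : (1 - η ^ 2) * t ≤ m := le_min (by nlinarith [mul_pos (pow_pos hη0 2) ht0]) htt'
  have hmt : Icc 0 m ⊆ Icc 0 t := Icc_subset_Icc_right (min_le_left _ _)
  have hmt' : Icc 0 m ⊆ Icc 0 t' := Icc_subset_Icc_right (min_le_right _ _)
  have hTsub : Icc 0 T ⊆ Icc 0 t' := Icc_subset_Icc_right hTt'
  have hβm := abs_lt.1 (hdist y z t' (by linarith) β hβ hβd m
    ⟨by linarith, min_le_right _ _⟩ hm1)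
  have hγT := abs_lt.1 (hdist y w t' (by linarith) γ hγ hγd T ⟨by linarith, hTt'⟩ ht)
  have hγmono : StrictMonoOn γ (Icc 0 T) :=
    (hγ.mono hTsub).strictMonoOn (by linarith) (by nlinarith)
  have hend : γ T ≤ β m := by
    have h₁ : (1 + η) * T ≤ (1 - η) * m := by
      rw [hT]
      calc (1 + η) * ((1 - η) ^ 2 * t) = (1 - η) * ((1 - η ^ 2) * t) := by ring
        _ ≤ (1 - η) * m := mul_le_mul_of_nonneg_left hmc (by linarith)
    linarith
  have hmaps : MapsTo γ (Icc 0 T) (β '' Icc 0 m) := by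
    intro s hs
    refine intermediate_value_Icc (by linarith) (hβ.1.mono hmt') ⟨?_, ?_⟩
    · rw [hβ.2.2, ← hγ.2.2]
      exact hγmono.monotoneOn ⟨le_rfl, by linarith⟩ hs hs.1
    · exact (hγmono.monotoneOn hs ⟨by linarith, le_rfl⟩ hs.2).trans hend
  refine ⟨_, IsReparOn.comp_invFunOn_comp isCompact_Icc ⟨le_rfl, by linarith⟩ (hα.mono hmt)
    (hβ.mono hmt') (hγ.mono hTsub) hmaps, fun s hs => ?_⟩
  have hu : Function.invFunOn β (Icc 0 m) (γ s) ∈ Icc 0 m := Function.invFunOn_mem (hmaps hs)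
  have hβu : β (Function.invFunOn β (Icc 0 m) (γ s)) = γ s := Function.invFunOn_eq (hmaps hs)
  have h₁ := hαd _ (hmt hu)
  have h₂ := hβd _ (hmt' hu)
  have h₃ := hγd s (hTsub hs)
  rw [hβu, dist_comm] at h₂
  exact (dist_triangle4 _ _ _ _).trans_lt (by linarith)

theorem reparBall_mono_radius [PseudoMetricSpace X] {φ : ℝ → X → X} (x : X) (t : ℝ)
    {r r' : ℝ} (h : r ≤ r') : reparBall φ x t r ⊆ reparBall φ x t r' :=
  fun _ ⟨α, hα, hd⟩ => ⟨α, hα, fun s hs => (hd s hs).trans_le h⟩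

/-- **Vitali-type covering lemma for reparametrization balls.** From any family of
reparametrization balls of common radius `0 < r < θ/2` and times `t > 1/(1−η)²`, one can
extract a countable pairwise disjoint subfamily whose `(1−η)²t`-time, `5r`-radius
enlargements cover the union of the original family. -/
theorem reparBall_vitali {X : Type*} [MetricSpace X] [CompactSpace X]
    (φ : ℝ → X → X) (hφ : IsFlow φ) (hfp : FixedPointFree φ)
    (η θ : ℝ) (hη0 : 0 < η) (hη1 : η < 1) (hθ0 : 0 < θ)
    (hθ : ∀ x y : X, ∀ a b : ℝ, a ≤ 0 → 0 ≤ b → ∀ α : ℝ → ℝ,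
      IsReparOn α (Set.Icc a b) →
      (∀ s ∈ Set.Icc a b, dist (φ (α s) x) (φ s y) < θ) →
      ∀ s ∈ Set.Icc a b, (1 < |s| → |α s - s| < η * |s|) ∧ (|s| ≤ 1 → |α s - s| < η))
    (r : ℝ) (hr0 : 0 < r) (hrθ : r < θ / 2)
    (I : Set (X × ℝ)) (hI : ∀ p ∈ I, 1 / (1 - η) ^ 2 < p.2) :
    ∃ I' ⊆ I, I'.Countable ∧
      (∀ p ∈ I', ∀ q ∈ I', p ≠ q →
        Disjoint (reparBall φ p.1 p.2 r) (reparBall φ q.1 q.2 r)) ∧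
      (⋃ p ∈ I, reparBall φ p.1 p.2 r) ⊆
        ⋃ p ∈ I', reparBall φ p.1 ((1 - η) ^ 2 * p.2) (5 * r) := by
  have hη2 : 0 < (1 - η) ^ 2 := pow_pos (sub_pos.2 hη1) 2
  have hηsq : 0 < 1 - η ^ 2 := by nlinarith
  have hI' : ∀ p ∈ I, 1 < (1 - η) ^ 2 * p.2 := fun p hp => by
    have := (div_lt_iff₀ hη2).1 (hI p hp)
    linarith
  have htime : ∀ p ∈ I, 1 < p.2 := fun p hp => by
    have := hI' p hp
    by_contra! h
    nlinarith
  have hdist : ∀ x y : X, ∀ b : ℝ, 0 ≤ b → ∀ α : ℝ → ℝ, IsReparOn α (Icc 0 b) →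
      (∀ s ∈ Icc 0 b, dist (φ (α s) x) (φ s y) < r) →
      ∀ s ∈ Icc 0 b, 1 < s → |α s - s| < η * s := by
    intro x y b hb α hα hd s hs hs1
    have h := (hθ x y 0 b le_rfl hb α hα
      (fun s hs => (hd s hs).trans (by linarith)) s hs).1
    rw [abs_of_nonneg hs.1] at h
    exact h hs1
  obtain ⟨J, hJI, hJd, hJ⟩ := Vitali.exists_disjoint_subfamily_covering_enlargement
    (fun p : X × ℝ => reparBall φ p.1 p.2 r) I (fun p => p.2⁻¹) (1 - η ^ 2)⁻¹
    ((one_lt_inv₀ hηsq).2 (by nlinarith))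
    (fun p hp => inv_nonneg.2 (zero_le_one.trans (htime p hp).le)) 1
    (fun p hp => inv_le_one_of_one_le₀ (htime p hp).le)
    (fun p _ => ⟨p.1, mem_of_mem_nhds (reparBall_mem_nhds hφ p.1 p.2 hr0)⟩)
  refine ⟨J, hJI, hJd.countable_of_nonempty_interior fun p _ =>
    ⟨p.1, mem_interior_iff_mem_nhds.2 (reparBall_mem_nhds hφ p.1 p.2 hr0)⟩,
    fun p hp q hq hpq => hJd hp hq hpq, ?_⟩
  refine iUnion₂_subset fun q hq => ?_
  obtain ⟨p, hp, hne, hle⟩ := hJ q hq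
  have hp1 := htime p (hJI hp)
  have hq1 := htime q hq
  have hpq : (1 - η ^ 2) * p.2 ≤ q.2 := by
    rw [← mul_inv] at hle
    exact (inv_le_inv₀ (by linarith) (by positivity)).1 hle
  exact ((reparBall_subset_of_inter_nonempty hη0 hη1 hdist (hI' p (hJI hp)) hq1 hpq
    (inter_comm _ _ ▸ hne)).trans (reparBall_mono_radius _ _ (by linarith))).trans
    (subset_biUnion_of_mem (u := fun p : X × ℝ =>
      reparBall φ p.1 ((1 - η) ^ 2 * p.2) (5 * r)) hp)

end FlowEntropy
end
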